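/- Let U be a finite index subgroup of F₂ satisfying Property B. Then for all n, m ≥ 1 with n dividing m: Stab(H_m) ⊆ Stab(Hₙ) and Γ(H_m) ⊆ Γ(Hₙ). -/

import Mathlib

/-- The free group on two generators. -/
abbrev F2 := FreeGroup (Fin 2)

/-- The generator `x` of `F₂`. -/
def xg : F2 := FreeGroup.of 0

/-- The generator `y` of `F₂`. -/
def yg : F2 := FreeGroup.of 1

/-- The exponent sum of the `i`-th generator, i.e. the `i`-th coordinate of the image in the
abelianization `ℤ²` of `F₂`. -/
def expSum (i : Fin 2) : F2 →* Multiplicative ℤ :=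
  FreeGroup.lift fun j => Multiplicative.ofAdd (if j = i then (1 : ℤ) else 0)

/-- The matrix in `GL₂(ℤ)` induced by an automorphism `γ` of `F₂` on the abelianization
`F₂^ab ≅ ℤ²` (with basis the images of `x` and `y`); i.e. `β̂(γ)`. -/
def autMat (γ : F2 ≃* F2) : Matrix (Fin 2) (Fin 2) ℤ :=
  Matrix.of fun i j => Multiplicative.toAdd (expSum i (γ (FreeGroup.of j)))

abbrev SL2Z := Matrix.SpecialLinearGroup (Fin 2) ℤ

/-- `Stab(V) = {γ ∈ Aut⁺(F₂) : γ(V) = V}`. -/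
def StabSet (V : Subgroup F2) : Set (F2 ≃* F2) :=
  { γ | (autMat γ).det = 1 ∧ Subgroup.map γ.toMonoidHom V = V }

/-- The Veech group `Γ(V) = β̂(Stab(V)) ⊆ SL₂(ℤ)` of a subgroup `V` of `F₂`. -/
def VeechGroup (V : Subgroup F2) : Set SL2Z :=
  { A | ∃ γ : F2 ≃* F2, γ ∈ StabSet V ∧ (A : Matrix (Fin 2) (Fin 2) ℤ) = autMat γ }

/-- A set of elements of `SL₂(ℤ)` is a congruence group if it contains the principal congruence
subgroup `Γ(n)` for some `n ≥ 1`. -/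
def IsCongruenceSet (S : Set SL2Z) : Prop :=
  ∃ n : ℕ, 1 ≤ n ∧ (CongruenceSubgroup.Gamma n : Set SL2Z) ⊆ S

/-- The subgroup of `Multiplicative ℤ` of elements divisible by `n`. -/
def divSub (n : ℤ) : Subgroup (Multiplicative ℤ) where
  carrier := {d | n ∣ Multiplicative.toAdd d}
  one_mem' := dvd_zero n
  mul_mem' := fun ha hb => dvd_add ha hb
  inv_mem' := fun ha => dvd_neg.mpr ha

/-- The subgroup `Hₙ = {u ∈ U : n ∣ α(u)}` of `F₂` (for `n = 0` this is `ker α = H₀`). -/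
def Hgrp {U : Subgroup F2} (α : U →* Multiplicative ℤ) (n : ℕ) : Subgroup F2 :=
  Subgroup.map U.subtype (Subgroup.comap α (divSub (n : ℤ)))

/-- The subgroup `U_L` of `F₂` corresponding to the origami `L(2,3)`. -/
def UL : Subgroup F2 :=
  Subgroup.closure {xg ^ 3, xg * yg * xg⁻¹, xg ^ 2 * yg * (xg ^ 2)⁻¹, yg * xg * yg⁻¹, yg ^ 2}

/-- The subgroup `U_D` of `F₂` corresponding to the origami `D`. -/
def UD : Subgroup F2 :=
  Subgroup.closure {xg ^ 3, xg * yg * (xg ^ 2)⁻¹, xg ^ 2 * yg * xg⁻¹, yg * xg * yg⁻¹,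
    yg ^ 2 * xg * (yg ^ 2)⁻¹, yg ^ 3}

theorem mem_Hgrp {U : Subgroup F2} (α : U →* Multiplicative ℤ) (n : ℕ) (v : F2) :
    v ∈ Hgrp α n ↔ ∃ hv : v ∈ U, (n : ℤ) ∣ Multiplicative.toAdd (α ⟨v, hv⟩) := by
  constructor
  · rintro ⟨u, hu, rfl⟩
    exact ⟨u.2, hu⟩
  · rintro ⟨hv, h⟩
    exact ⟨⟨v, hv⟩, h, rfl⟩

theorem map_eq_self_iff {G : Type*} [Group G] (γ : G ≃* G) (V : Subgroup G) :
    Subgroup.map γ.toMonoidHom V = V ↔ ∀ v, γ v ∈ V ↔ v ∈ V := by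
  constructor
  · intro h v
    conv_lhs => rw [← h]
    exact Subgroup.mem_map_iff_mem γ.injective
  · intro h
    ext v
    obtain ⟨w, rfl⟩ := γ.surjective v
    rw [h]
    exact Subgroup.mem_map_iff_mem γ.injective

/-- For `d ≥ 1`, `Hₙ` consists of the elements of `U` whose `d`-th power lies in `H_{nd}`. -/
theorem mem_Hgrp_iff_pow_mem {U : Subgroup F2} (α : U →* Multiplicative ℤ) (n d : ℕ)
    (hd : d ≠ 0) (v : F2) : v ∈ Hgrp α n ↔ v ∈ U ∧ v ^ d ∈ Hgrp α (n * d) := by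
  have key (hv : v ∈ U) (hvd : v ^ d ∈ U) :
      Multiplicative.toAdd (α ⟨v ^ d, hvd⟩) = Multiplicative.toAdd (α ⟨v, hv⟩) * d := by
    have h : (⟨v ^ d, hvd⟩ : U) = ⟨v, hv⟩ ^ d := rfl
    rw [h, map_pow, toAdd_pow, nsmul_eq_mul, mul_comm]
  have hd' : (d : ℤ) ≠ 0 := by exact_mod_cast hd
  simp only [mem_Hgrp]
  constructor
  · rintro ⟨hv, h⟩
    refine ⟨hv, pow_mem hv d, ?_⟩
    rw [key hv, Nat.cast_mul]
    exact mul_dvd_mul_right h _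
  · rintro ⟨hv, hvd, h⟩
    rw [key hv, Nat.cast_mul] at h
    exact ⟨hv, Int.dvd_of_mul_dvd_mul_right hd' h⟩

/-- Under Property B, `U` is the normalizer of each `Hₙ`. -/
theorem mem_iff_conj_mem_Hgrp {U : Subgroup F2} (α : U →* Multiplicative ℤ)
    (hB : ∀ w : F2, w ∉ U → ¬ ∀ h ∈ Hgrp α 0, w * h * w⁻¹ ∈ U) (n : ℕ) (w : F2) :
    w ∈ U ↔ ∀ h ∈ Hgrp α n, w * h * w⁻¹ ∈ Hgrp α n := by
  simp only [mem_Hgrp] at hB ⊢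
  constructor
  · rintro hw h ⟨hU, hh⟩
    refine ⟨U.mul_mem (U.mul_mem hw hU) (U.inv_mem hw), ?_⟩
    have e : α ⟨w * h * w⁻¹, U.mul_mem (U.mul_mem hw hU) (U.inv_mem hw)⟩ = α ⟨h, hU⟩ := by
      change α (⟨w, hw⟩ * ⟨h, hU⟩ * ⟨w, hw⟩⁻¹) = _
      rw [map_mul, map_mul, map_inv, mul_inv_cancel_comm]
    rwa [e]
  · intro hw
    by_contra hwU
    refine hB w hwU ?_
    rintro h ⟨hU, hh⟩
    exact (hw h ⟨hU, (Int.natCast_dvd_natCast.mpr (dvd_zero n)).trans hh⟩).1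

theorem stabSet_Hgrp_subset {U : Subgroup F2} (α : U →* Multiplicative ℤ)
    (hB : ∀ w : F2, w ∉ U → ¬ ∀ h ∈ Hgrp α 0, w * h * w⁻¹ ∈ U) (n d : ℕ) (hd : d ≠ 0) :
    StabSet (Hgrp α (n * d)) ⊆ StabSet (Hgrp α n) := by
  rintro γ ⟨hdet, hγ⟩
  refine ⟨hdet, ?_⟩
  rw [map_eq_self_iff] at hγ ⊢
  have hU (w : F2) : γ w ∈ U ↔ w ∈ U := by
    rw [mem_iff_conj_mem_Hgrp α hB (n * d), mem_iff_conj_mem_Hgrp α hB (n * d),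
      γ.surjective.forall]
    refine forall_congr' fun h => ?_
    rw [← map_inv, ← map_mul, ← map_mul, hγ, hγ]
  intro v
  rw [mem_Hgrp_iff_pow_mem α n d hd, mem_Hgrp_iff_pow_mem α n d hd, hU, ← map_pow, hγ]

/-- Setting A with Property B: for all `n, m ≥ 1` with `n ∣ m`, `Stab(H_m) ⊆ Stab(Hₙ)`
and `Γ(H_m) ⊆ Γ(Hₙ)`. -/
theorem stab_Hm_subset_stab_Hn_of_dvd
    (k : ℕ) (hk : 2 ≤ k) (U : Subgroup F2) (hfin : U.FiniteIndex)
    (g : Fin k → F2)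
    -- `g` is a free basis of `U`:
    (hgen : Subgroup.closure (Set.range g) = U)
    (hfree : Function.Injective ⇑(FreeGroup.lift g : FreeGroup (Fin k) →* F2))
    (hgU : ∀ j, g j ∈ U)
    -- `α : U → ℤ` is the homomorphism with `α(g₁) = 1` and `α(gⱼ) = 0` for `j ≥ 2`:
    (α : U →* Multiplicative ℤ)
    (hα0 : α ⟨g ⟨0, by omega⟩, hgU _⟩ = Multiplicative.ofAdd 1)
    (hαj : ∀ j : Fin k, j ≠ ⟨0, by omega⟩ → α ⟨g j, hgU j⟩ = 1)
    -- Property B: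
    (hB : ∀ w : F2, w ∉ U → ¬ ∀ h ∈ Hgrp α 0, w * h * w⁻¹ ∈ U)
    : ∀ n m : ℕ, 1 ≤ n → 1 ≤ m → n ∣ m →
      StabSet (Hgrp α m) ⊆ StabSet (Hgrp α n) ∧
      VeechGroup (Hgrp α m) ⊆ VeechGroup (Hgrp α n) := by
  rintro n m - hm ⟨d, rfl⟩
  have hsub := stabSet_Hgrp_subset α hB n d (by rintro rfl; simp at hm)
  exact ⟨hsub, fun A ⟨γ, hγ, hA⟩ => ⟨γ, hsub hγ, hA⟩⟩
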